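/- The symmetric bilinear form B on the real vector space spanned by simple roots of a Coxeter system, defined by B(α_s, α_t) = -2cos(π/m_{s,t}) (with convention -2cos(π/∞) = -2) and B(α_s, α_s) = 2, is positive definite if and only if the Coxeter group W is finite. -/

import Mathlib

/-!
STATEMENT 0: The symmetric bilinear form B on the real vector space spanned by the simple
roots of a Coxeter system, with B(α_s, α_t) = -2cos(π/m_{s,t}) (convention -2cos(π/∞) = -2,
encoded by m = 0) is positive definite if and only if the Coxeter group W is finite.
-/

/-- The entry `-2 cos (π / m_{s,t})` of the Coxeter bilinear form, with the convention that
`m_{s,t} = 0` encodes `m_{s,t} = ∞` and produces `-2`.  Note that the diagonal entries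
`m_{s,s} = 1` produce `-2 cos π = 2`. -/
noncomputable def coxEntry {B : Type*} (M : CoxeterMatrix B) (s t : B) : ℝ :=
  if M s t = 0 then -2 else -2 * Real.cos (Real.pi / (M s t))

/-- The symmetric bilinear form of the Tits representation, on `RΛ = ⊕_{s} ℝ·α_s ≅ (B → ℝ)`,
determined by `B(α_s, α_t) = -2 cos (π / m_{s,t})`. -/
noncomputable def coxForm {B : Type*} [Fintype B] (M : CoxeterMatrix B) (v w : B → ℝ) : ℝ :=
  ∑ s, ∑ t, v s * w t * coxEntry M s t


open CoxeterSystem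

section CoxAux

set_option linter.unusedSectionVars false

variable {B : Type*} [Fintype B] [DecidableEq B] (M : CoxeterMatrix B)

noncomputable def cB : LinearMap.BilinForm ℝ (B → ℝ) :=
  Matrix.toBilin' (Matrix.of (coxEntry M))

lemma coxForm_eq (v w : B → ℝ) : coxForm M v w = cB M v w := by
  rw [cB, Matrix.toBilin'_apply, coxForm]
  refine Finset.sum_congr rfl fun s _ => Finset.sum_congr rfl fun t _ => ?_
  simp only [Matrix.of_apply]; ring

lemma coxEntry_symm (s t : B) : coxEntry M s t = coxEntry M t s := by
  simp only [coxEntry, M.symmetric s t]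

lemma coxEntry_self (s : B) : coxEntry M s s = 2 := by
  simp [coxEntry]

lemma coxEntry_of_ne (s t : B) (h : M s t ≠ 0) :
    coxEntry M s t = -2 * Real.cos (Real.pi / (M s t)) := by
  simp [coxEntry, h]

noncomputable def al (s : B) : B → ℝ := Pi.single s 1

lemma cB_al (s t : B) : cB M (al s) (al t) = coxEntry M s t := by
  rw [cB, al, al, Matrix.toBilin'_single]; rfl

lemma cB_symm (v w : B → ℝ) : cB M v w = cB M w v := by
  rw [← coxForm_eq, ← coxForm_eq, coxForm, coxForm, Finset.sum_comm]
  refine Finset.sum_congr rfl fun s _ => Finset.sum_congr rfl fun t _ => ?_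
  rw [coxEntry_symm]; ring

lemma cB_self (s : B) : cB M (al s) (al s) = 2 := by
  rw [cB_al, coxEntry_self]

noncomputable def rf (s : B) : (B → ℝ) ≃ₗ[ℝ] (B → ℝ) :=
  Module.reflection (f := cB M (al s)) (x := al s) (cB_self M s)

lemma rf_apply (s : B) (v : B → ℝ) : rf M s v = v - cB M (al s) v • al s := by
  rw [rf, Module.reflection_apply]

lemma two_le_of_ne {s t : B} (h : s ≠ t) (h0 : M s t ≠ 0) : 2 ≤ M s t := by
  have := M.off_diagonal s t h
  omega

lemma rf_liftable : M.IsLiftable (rf M) := by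
  intro s t
  by_cases h0 : M s t = 0
  · simp [h0]
  by_cases hst : s = t
  · subst hst
    rw [M.diagonal, pow_one]
    apply LinearEquiv.ext
    intro v
    exact Module.involutive_reflection (cB_self M s) v
  have h2 := two_le_of_ne M hst h0
  have hB := coxEntry_of_ne M s t h0
  by_cases h2' : M s t = 2
  · have hB0 : coxEntry M s t = 0 := by rw [hB, h2']; simp
    have hB0' : coxEntry M t s = 0 := by rw [coxEntry_symm, hB0]
    rw [h2']
    apply LinearEquiv.ext
    intro v
    simp only [pow_two, LinearEquiv.mul_apply, rf_apply, map_sub, map_smul, cB_al, hB0, hB0',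
      coxEntry_self, LinearEquiv.coe_one, id]
    simp
    module
  apply LinearEquiv.ext
  intro v
  set m := M s t with hm
  set θ : ℝ := Real.pi / m with hθ
  have hmpos : (3 : ℝ) ≤ m := by exact_mod_cast (by omega : 3 ≤ m)
  have hmθ : m * θ = Real.pi := by rw [hθ]; field_simp
  have ht : 2 * Real.cos (2 * θ) =
      cB M (al s) (al t) * cB M (al t) (al s) - 2 := by
    rw [cB_al, cB_al, coxEntry_symm M t s, hB, Real.cos_two_mul]; ring
  have hpi := Real.pi_pos
  have hθ0 : 0 < θ := by rw [hθ]; positivity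
  have hsin : Real.sin (2 * θ) ≠ 0 := by
    apply ne_of_gt
    apply Real.sin_pos_of_pos_of_lt_pi <;> nlinarith
  have key := fun n : ℤ => Polynomial.Chebyshev.S_two_mul_real_cos (2 * θ) n
  rw [rf, rf, Module.reflection_mul_reflection_pow_apply _ _ _ _ _ ht]
  obtain ⟨k, hk⟩ := Nat.even_or_odd' m
  rcases hk with hk | hk
  · have e1 : ((m : ℤ) - 2) / 2 = k - 1 := by omega
    have e2 : ((m : ℤ) - 1) / 2 = k - 1 := by omega
    have hz : (Polynomial.Chebyshev.S ℝ ((k : ℤ) - 1)).eval (2 * Real.cos (2 * θ)) = 0 := by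
      have := key (k - 1)
      have e : (((k : ℤ) - 1 : ℤ) + 1 : ℝ) * (2 * θ) = Real.pi := by
        rw [← hmθ, hk]; push_cast; ring
      rw [e, Real.sin_pi] at this
      exact (mul_eq_zero.mp this).resolve_right hsin
    rw [e1, e2, hz]; simp
  · have e1 : ((m : ℤ) - 2) / 2 = k - 1 := by omega
    have e2 : ((m : ℤ) - 1) / 2 = k := by omega
    have e3 : ((m : ℤ) - 3) / 2 = k - 1 := by omega
    have e4 : (m : ℤ) / 2 = k := by omega
    have hz : (Polynomial.Chebyshev.S ℝ (k : ℤ)).eval (2 * Real.cos (2 * θ)) +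
        (Polynomial.Chebyshev.S ℝ ((k : ℤ) - 1)).eval (2 * Real.cos (2 * θ)) = 0 := by
      have h1 := key (k - 1)
      have h2 := key k
      have e : (((k : ℤ) - 1 : ℤ) + 1 : ℝ) * (2 * θ) = Real.pi - θ := by
        rw [← hmθ, hk]; push_cast; ring
      have e' : ((k : ℤ) + 1 : ℝ) * (2 * θ) = θ + Real.pi := by
        rw [← hmθ, hk]; push_cast; ring
      rw [e, Real.sin_pi_sub] at h1
      rw [e', Real.sin_add_pi] at h2
      have : ((Polynomial.Chebyshev.S ℝ (k : ℤ)).eval (2 * Real.cos (2 * θ)) +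
        (Polynomial.Chebyshev.S ℝ ((k : ℤ) - 1)).eval (2 * Real.cos (2 * θ))) *
          Real.sin (2 * θ) = 0 := by rw [add_mul, h1, h2]; ring
      exact (mul_eq_zero.mp this).resolve_right hsin
    rw [e1, e2, e3, e4, hz]; simp

variable {M} {W : Type*} [Group W] (cs : CoxeterSystem M W)

noncomputable def tits : W →* ((B → ℝ) ≃ₗ[ℝ] (B → ℝ)) := cs.lift ⟨rf M, rf_liftable M⟩

lemma tits_simple (s : B) : tits cs (cs.simple s) = rf M s := by
  rw [tits, lift_apply_simple]

lemma cB_rf (s : B) (v u : B → ℝ) : cB M (rf M s v) (rf M s u) = cB M v u := by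
  simp only [rf_apply, map_sub, map_smul, LinearMap.sub_apply, LinearMap.smul_apply, smul_eq_mul,
    cB_self, cB_symm M v (al s)]
  ring

lemma cB_tits (w : W) (v u : B → ℝ) : cB M (tits cs w v) (tits cs w u) = cB M v u := by
  induction w using cs.simple_induction_left with
  | one => simp
  | mul_simple_left w i ih =>
    rw [map_mul, LinearEquiv.mul_apply, LinearEquiv.mul_apply, tits_simple, cB_rf, ih]

/-! Finite implies positive definite -/

lemma posDef_of_finite (cs : CoxeterSystem M W) [Finite W] (v : B → ℝ) (hv : v ≠ 0) : 0 < cB M v v := by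
  classical
  have := Fintype.ofFinite W
  let I : LinearMap.BilinForm ℝ (B → ℝ) :=
    ∑ w : W, (Matrix.toBilin' (1 : Matrix B B ℝ)).comp (tits cs w : (B → ℝ) →ₗ[ℝ] (B → ℝ))
      (tits cs w : (B → ℝ) →ₗ[ℝ] (B → ℝ))
  have hI (x y : B → ℝ) : I x y = ∑ w : W, tits cs w x ⬝ᵥ tits cs w y := by
    simp [I, Matrix.toBilin'_apply', LinearMap.BilinForm.comp_apply]
  have hIpos (x : B → ℝ) (hx : x ≠ 0) : 0 < I x x := by
    rw [hI]
    apply Finset.sum_pos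
    · intro w _
      have h : tits cs w x ≠ 0 := by simpa using hx
      have h1 := Matrix.dotProduct_star_self_pos_iff.mpr h
      simpa using h1
    · exact ⟨1, Finset.mem_univ _⟩
  have hIsymm (x y : B → ℝ) : I x y = I y x := by
    rw [hI, hI]; exact Finset.sum_congr rfl fun w _ => dotProduct_comm _ _
  have hIinv (s : B) (x y : B → ℝ) : I (rf M s x) (rf M s y) = I x y := by
    rw [hI, hI, ← tits_simple cs]
    refine Fintype.sum_equiv (Equiv.mulRight (cs.simple s)) _ _ fun w => ?_
    simp [map_mul, LinearEquiv.mul_apply]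
  have hal (s : B) : (al s : B → ℝ) ≠ 0 := by simp [al]
  set c : B → ℝ := fun s => I (al s) (al s) / 2 with hc
  have hcpos (s : B) : 0 < c s := half_pos (hIpos _ (hal s))
  have hIal (s : B) (x : B → ℝ) : I (al s) x = c s * cB M (al s) x := by
    have h := hIinv s (al s) x
    rw [rf_apply, rf_apply, cB_self] at h
    simp only [map_sub, map_smul, LinearMap.sub_apply, LinearMap.smul_apply, smul_eq_mul] at h
    simp only [hc]
    linarith
  have hcc (s t : B) : coxEntry M s t = 0 ∨ c s = c t := by
    by_cases h : coxEntry M s t = 0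
    · exact Or.inl h
    right
    have h1 := hIal s (al t)
    have h2 := hIal t (al s)
    rw [hIsymm, h2, cB_al, cB_al, coxEntry_symm M t s] at h1
    exact (mul_right_cancel₀ h h1).symm
  have hIexp (x : B → ℝ) : I x x = ∑ s, ∑ t, x s * (c s * coxEntry M s t) * x t := by
    conv_lhs => rw [← Matrix.toBilin'_toMatrix' I, Matrix.toBilin'_apply]
    refine Finset.sum_congr rfl fun s _ => Finset.sum_congr rfl fun t _ => ?_
    rw [LinearMap.BilinForm.toMatrix'_apply, ← cB_al, ← hIal]; rfl
  have hsq (s : B) : 0 < √(c s) := Real.sqrt_pos.mpr (hcpos s)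
  have : cB M v v = I (fun s => v s / √(c s)) (fun s => v s / √(c s)) := by
    rw [hIexp, ← coxForm_eq, coxForm]
    refine Finset.sum_congr rfl fun s _ => Finset.sum_congr rfl fun t _ => ?_
    rcases hcc s t with h | h
    · simp [h]
    · have h0 := (hsq t).ne'
      rw [h]
      nth_rw 2 [← Real.mul_self_sqrt (hcpos t).le]
      field_simp
  rw [this]
  apply hIpos
  intro h
  apply hv
  funext s
  have := congrFun h s
  simpa [(hsq s).ne'] using this

/-! Positive definite implies finite -/

lemma tits_alternatingWord (s t : B) (hst : s ≠ t) (h0 : M s t ≠ 0) (k : ℕ) :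
    tits cs (cs.wordProd (alternatingWord s t k)) (al s) =
      if Even k then
        (Real.sin ((k + 1) * (Real.pi / M s t)) / Real.sin (Real.pi / M s t)) • al s +
          (Real.sin (k * (Real.pi / M s t)) / Real.sin (Real.pi / M s t)) • al t
      else
        (Real.sin (k * (Real.pi / M s t)) / Real.sin (Real.pi / M s t)) • al s +
          (Real.sin ((k + 1) * (Real.pi / M s t)) / Real.sin (Real.pi / M s t)) • al t := by
  have h2 := two_le_of_ne M hst h0
  have hB := coxEntry_of_ne M s t h0
  have hB' := hB
  rw [coxEntry_symm] at hB'
  set θ : ℝ := Real.pi / M s t with hθ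
  have hm : (2 : ℝ) ≤ M s t := by exact_mod_cast h2
  have hpi := Real.pi_pos
  have hmθ : M s t * θ = Real.pi := by rw [hθ]; field_simp
  have hθ0 : 0 < θ := by rw [hθ]; positivity
  have hsin : Real.sin θ ≠ 0 := by
    apply ne_of_gt
    apply Real.sin_pos_of_pos_of_lt_pi <;> nlinarith
  have hrec (x : ℝ) : Real.sin ((x + 1 + 1) * θ) =
      2 * Real.cos θ * Real.sin ((x + 1) * θ) - Real.sin (x * θ) := by
    have e1 : (x + 1 + 1) * θ = (x + 1) * θ + θ := by ring
    have e2 : x * θ = (x + 1) * θ - θ := by ring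
    rw [e1, e2, Real.sin_add, Real.sin_sub]; ring
  induction k with
  | zero => simp [alternatingWord, hsin]
  | succ k ih =>
    rw [alternatingWord_succ', wordProd_cons, map_mul, LinearEquiv.mul_apply, ih]
    by_cases hk : Even k
    · have hk' : ¬ Even (k + 1) := by simp [hk, parity_simps]
      rw [if_pos hk, if_pos hk, if_neg hk', tits_simple, rf_apply]
      simp only [map_add, map_smul, cB_al, coxEntry_self, hB', smul_eq_mul]
      push_cast
      rw [hrec]
      match_scalars
      · ring
      · field_simp; ring
    · have hk' : Even (k + 1) := by simp [hk, parity_simps]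
      rw [if_neg hk, if_neg hk, if_pos hk', tits_simple, rf_apply]
      simp only [map_add, map_smul, cB_al, coxEntry_self, hB, smul_eq_mul]
      push_cast
      rw [hrec]
      match_scalars
      · field_simp; ring
      · ring

lemma tits_alternatingWord_nonneg (s t : B) (hst : s ≠ t) (h0 : M s t ≠ 0) (k : ℕ)
    (hk : k < M s t) :
    ∃ p q : ℝ, 0 ≤ p ∧ 0 ≤ q ∧
      tits cs (cs.wordProd (alternatingWord s t k)) (al s) = p • al s + q • al t := by
  rw [tits_alternatingWord cs s t hst h0]
  have h2 := two_le_of_ne M hst h0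
  have hm : (2 : ℝ) ≤ M s t := by exact_mod_cast h2
  have hk' : (k : ℝ) + 1 ≤ M s t := by exact_mod_cast hk
  have hpi := Real.pi_pos
  set θ : ℝ := Real.pi / M s t with hθ
  have hmθ : M s t * θ = Real.pi := by rw [hθ]; field_simp
  have hθ0 : 0 < θ := by rw [hθ]; positivity
  have hsin : 0 ≤ Real.sin θ := by
    apply Real.sin_nonneg_of_nonneg_of_le_pi <;> nlinarith
  have h1 : 0 ≤ Real.sin (k * θ) / Real.sin θ := by
    apply div_nonneg _ hsin
    apply Real.sin_nonneg_of_nonneg_of_le_pi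
    · positivity
    · rw [← hmθ]; gcongr
  have h2 : 0 ≤ Real.sin ((k + 1) * θ) / Real.sin θ := by
    apply div_nonneg _ hsin
    apply Real.sin_nonneg_of_nonneg_of_le_pi
    · positivity
    · rw [← hmθ]; gcongr
  split_ifs
  · exact ⟨_, _, h2, h1, rfl⟩
  · exact ⟨_, _, h1, h2, rfl⟩

lemma tits_nonneg (h0 : ∀ s t, M s t ≠ 0) (n : ℕ) : ∀ (w : W) (s : B), cs.length w = n →
    ¬ cs.IsRightDescent w s → 0 ≤ tits cs w (al s) := by
  classical
  induction n using Nat.strong_induction_on with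
  | _ n ih =>
  intro w s hn hs
  by_cases hw : w = 1
  · subst hw
    simp [al]
  obtain ⟨t, ht⟩ := cs.exists_rightDescent_of_ne_one hw
  have hst : s ≠ t := by rintro rfl; exact hs ht
  let P : ℕ → Prop := fun k => ∃ v : W, w = v * cs.wordProd (alternatingWord s t k) ∧
    cs.length v + k = cs.length w
  have hP1 : P 1 := by
    refine ⟨w * cs.simple t, ?_, cs.isRightDescent_iff.mp ht⟩
    simp [alternatingWord]
  have h1n : 1 ≤ cs.length w := by
    obtain ⟨v, _, h⟩ := hP1
    omega
  obtain ⟨k, hk1, hPk, hmax⟩ : ∃ k, 1 ≤ k ∧ P k ∧ ¬ P (k + 1) := by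
    refine ⟨Nat.findGreatest P (cs.length w), Nat.le_findGreatest h1n hP1,
      Nat.findGreatest_spec h1n hP1, ?_⟩
    intro h
    have hle : Nat.findGreatest P (cs.length w) + 1 ≤ cs.length w := by
      obtain ⟨v, _, h⟩ := h
      omega
    have := Nat.le_findGreatest hle h
    omega
  obtain ⟨v, hv, hl⟩ := hPk
  -- the two simple reflections are not descents of `v`
  have hA : ¬ cs.IsRightDescent v (if Even k then t else s) := by
    intro h
    apply hmax
    refine ⟨v * cs.simple (if Even k then t else s), ?_, ?_⟩
    · rw [alternatingWord_succ', wordProd_cons, ← mul_assoc, simple_mul_simple_cancel_right, hv]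
    · rw [isRightDescent_iff] at h
      omega
  have hA' : ¬ cs.IsRightDescent v (if Even k then s else t) := by
    intro h
    obtain ⟨j, rfl⟩ : ∃ j, k = j + 1 := ⟨k - 1, by omega⟩
    have e : (if Even (j + 1) then s else t) = (if Even j then t else s) := by
      by_cases hj : Even j <;> simp [hj, parity_simps]
    rw [e, isRightDescent_iff] at h
    rw [alternatingWord_succ', wordProd_cons, ← mul_assoc] at hv
    have h3 := cs.length_mul_le (v * cs.simple (if Even j then t else s))
      (cs.wordProd (alternatingWord s t j))
    have h4 := cs.length_wordProd_le (alternatingWord s t j)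
    rw [length_alternatingWord] at h4
    rw [← hv] at h3
    omega
  have hvs : ¬ cs.IsRightDescent v s ∧ ¬ cs.IsRightDescent v t := by
    by_cases hk : Even k
    · simp only [hk, if_true] at hA hA'
      exact ⟨hA', hA⟩
    · simp only [hk, if_false] at hA hA'
      exact ⟨hA, hA'⟩
  have hkm : k < M s t := by
    by_contra hcon
    rcases Nat.lt_or_ge (M s t) k with hlt | hge
    · have h3 := cs.not_isReduced_alternatingWord s t (h0 s t) hlt
      have h4 := cs.length_wordProd_le (alternatingWord s t k)
      have h5 := cs.length_mul_le v (cs.wordProd (alternatingWord s t k))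
      rw [← hv] at h5
      rw [length_alternatingWord] at h4
      apply h3
      rw [CoxeterSystem.IsReduced, length_alternatingWord]
      omega
    · have hkk : k = M s t := by omega
      have hb := cs.wordProd_braidWord_eq s t
      rw [braidWord, braidWord, M.symmetric t s, ← hkk] at hb
      obtain ⟨j, rfl⟩ : ∃ j, k = j + 1 := ⟨k - 1, by omega⟩
      rw [hb, alternatingWord_succ, wordProd_concat, ← mul_assoc] at hv
      rw [not_isRightDescent_iff, hv, simple_mul_simple_cancel_right, ← hv] at hs
      have h4 := cs.length_wordProd_le (alternatingWord s t j)
      have h5 := cs.length_mul_le v (cs.wordProd (alternatingWord s t j))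
      rw [length_alternatingWord] at h4
      omega
  obtain ⟨p, q, hp, hq, hpq⟩ := tits_alternatingWord_nonneg cs s t hst (h0 s t) k hkm
  rw [hv, map_mul, LinearEquiv.mul_apply, hpq, map_add, map_smul, map_smul]
  have i1 := ih (cs.length v) (by omega) v s rfl hvs.1
  have i2 := ih (cs.length v) (by omega) v t rfl hvs.2
  exact add_nonneg (smul_nonneg hp i1) (smul_nonneg hq i2)

lemma tits_nonpos (h0 : ∀ s t, M s t ≠ 0) (w : W) (s : B)
    (h : cs.IsRightDescent w s) : tits cs w (al s) ≤ 0 := by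
  have h1 := tits_nonneg cs h0 _ (w * cs.simple s) s rfl
    (cs.isRightDescent_iff_not_isRightDescent_mul.mp h)
  rw [map_mul, LinearEquiv.mul_apply, tits_simple, rf_apply, cB_self] at h1
  have e : al s - (2 : ℝ) • al s = -al s := by module
  rw [e, map_neg] at h1
  simpa using h1

lemma finite_of_sep {V : Type*} [AddCommGroup V] [Module ℝ V] [FiniteDimensional ℝ V]
    (core : InnerProductSpace.Core ℝ V) (S : Set V) (c : ℝ)
    (hS : ∀ x ∈ S, core.inner x x = c)
    (hsep : ∀ x ∈ S, ∀ y ∈ S, x ≠ y → 1 / 2 ≤ core.inner (x - y) (x - y)) : S.Finite := by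
  let _ : NormedAddCommGroup V := core.toNormedAddCommGroup
  let _ : InnerProductSpace ℝ V := InnerProductSpace.ofCore core.toCore
  have hn (x : V) : core.inner x x = ‖x‖ ^ 2 := by
    exact real_inner_self_eq_norm_sq x
  have hproper : ProperSpace V := FiniteDimensional.proper ℝ V
  have hb : Bornology.IsBounded S := by
    rw [isBounded_iff_forall_norm_le]
    refine ⟨√c, fun x hx => ?_⟩
    rw [← hS x hx, hn]
    exact Real.le_sqrt_of_sq_le le_rfl
  have htb : TotallyBounded S := by
    exact hb.isCompact_closure.totallyBounded.subset subset_closure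
  obtain ⟨T, hT, hcov⟩ := Metric.totallyBounded_iff.mp htb (1 / 4) (by norm_num)
  choose! f hf using fun x (hx : x ∈ S) => Set.mem_iUnion₂.mp (hcov hx)
  refine Set.Finite.of_finite_image (f := f) (hT.subset ?_) ?_
  · rintro _ ⟨x, hx, rfl⟩
    exact (hf x hx).1
  · intro x hx y hy hxy
    by_contra hne
    have h1 := hsep x hx y hy hne
    rw [hn] at h1
    have d1 := Metric.mem_ball.mp (hf x hx).2
    have d2 := Metric.mem_ball.mp (hf y hy).2
    rw [← hxy] at d2
    have d3 := dist_triangle_right x y (f x)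
    rw [dist_eq_norm x y] at d3
    nlinarith [norm_nonneg (x - y)]

lemma finite_of_posDef (cs : CoxeterSystem M W) (hpos : ∀ v : B → ℝ, v ≠ 0 → 0 < cB M v v) :
    Finite W := by
  have h0 : ∀ s t, M s t ≠ 0 := by
    intro s t h
    have hst : s ≠ t := by
      rintro rfl
      simp at h
    have e : coxEntry M s t = -2 := by simp [coxEntry, h]
    have e' : coxEntry M t s = -2 := by rw [coxEntry_symm, e]
    have h1 := hpos (al s + al t) (by
      intro hz
      have := congrFun hz s
      simp [al, hst] at this)
    simp only [map_add, LinearMap.add_apply, cB_al, coxEntry_self, e, e'] at h1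
    norm_num at h1
  -- the vector `ρ`
  obtain ⟨ρ, hρ⟩ : ∃ ρ : B → ℝ, ∀ s, cB M ρ (al s) = 1 := by
    let φ : (B → ℝ) →ₗ[ℝ] (B → ℝ) := LinearMap.pi fun s => (cB M).flip (al s)
    have hinj : Function.Injective φ := by
      rw [← LinearMap.ker_eq_bot, LinearMap.ker_eq_bot']
      intro v hv
      by_contra hne
      have h1 := hpos v hne
      have h2 : cB M v = 0 := by
        apply LinearMap.pi_ext'
        intro s
        ext
        exact congrFun hv s
      rw [h2] at h1
      simp at h1
    obtain ⟨ρ, h⟩ := LinearMap.surjective_of_injective hinj (fun _ => 1)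
    exact ⟨ρ, fun s => congrFun h s⟩
  have hρneg (x : B → ℝ) (hx : x ≤ 0) : cB M ρ x ≤ 0 := by
    have e : x = ∑ s, x s • al s := by
      funext i
      simp [al, Finset.sum_apply, Pi.single_apply]
    rw [e, map_sum]
    apply Finset.sum_nonpos
    intro s _
    rw [map_smul, hρ, smul_eq_mul, mul_one]
    exact hx s
  have hbase (w : W) (hw : w ≠ 1) :
      1 / 2 ≤ cB M (tits cs w ρ - ρ) (tits cs w ρ - ρ) := by
    obtain ⟨s, hs⟩ := cs.exists_leftDescent_of_ne_one hw
    rw [← isRightDescent_inv_iff] at hs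
    have h1 := hρneg _ (tits_nonpos cs h0 _ s hs)
    rw [← cB_tits cs w, ← LinearEquiv.mul_apply, ← map_mul, mul_inv_cancel, map_one] at h1
    simp only [LinearEquiv.coe_one, id] at h1
    have h2 : cB M (tits cs w ρ - ρ) (al s) ≤ -1 := by
      rw [map_sub, LinearMap.sub_apply, hρ]
      linarith
    generalize tits cs w ρ - ρ = u at h2 ⊢
    have h3 : 0 ≤ cB M (u + (1 / 2 : ℝ) • al s) (u + (1 / 2 : ℝ) • al s) := by
      by_cases hz : u + (1 / 2 : ℝ) • al s = 0
      · rw [hz]; simp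
      · exact (hpos _ hz).le
    simp only [map_add, map_smul, LinearMap.add_apply, LinearMap.smul_apply, smul_eq_mul,
      cB_self, cB_symm M (al s) u] at h3
    linarith
  have hsep (w w' : W) (hw : w ≠ w') :
      1 / 2 ≤ cB M (tits cs w ρ - tits cs w' ρ) (tits cs w ρ - tits cs w' ρ) := by
    have h1 := hbase (w'⁻¹ * w) (by
      intro h
      exact hw (inv_mul_eq_one.mp h).symm)
    rw [← cB_tits cs w', map_sub, ← LinearEquiv.mul_apply, ← map_mul, mul_inv_cancel_left] at h1
    exact h1
  have hinj : Function.Injective fun w => tits cs w ρ := by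
    intro w w' h
    by_contra hne
    have h1 := hsep w w' hne
    simp only at h
    rw [h] at h1
    norm_num at h1
  let core : InnerProductSpace.Core ℝ (B → ℝ) :=
    { inner := fun x y => cB M x y
      conj_inner_symm := fun x y => by simp [cB_symm M x y]
      re_inner_nonneg := fun x => by
        by_cases hx : x = 0
        · simp [hx]
        · exact (hpos x hx).le
      add_left := fun x y z => by simp
      smul_left := fun x y r => by simp
      definite := fun x hx => by
        by_contra hne
        exact (hpos x hne).ne' hx }
  have hfin := finite_of_sep core (Set.range fun w => tits cs w ρ) (cB M ρ ρ)
    (by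
      rintro _ ⟨w, rfl⟩
      exact cB_tits cs w ρ ρ)
    (by
      rintro _ ⟨w, rfl⟩ _ ⟨w', rfl⟩ hne
      exact hsep w w' (fun h => hne (by rw [h])))
  exact Set.finite_range_iff hinj |>.mp hfin

end CoxAux

theorem coxForm_posDef_iff_finite {B : Type*} [Fintype B] [DecidableEq B]
    (M : CoxeterMatrix B) {W : Type*} [Group W] (cs : CoxeterSystem M W) :
    (∀ v : B → ℝ, v ≠ 0 → 0 < coxForm M v v) ↔ Finite W := by
  simp only [coxForm_eq]
  constructor
  · exact finite_of_posDef cs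
  · intro _ v hv
    exact posDef_of_finite cs v hv
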